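/- Let γ < 0 and assume (A.1) and (A.2). Then for each δ ∈ (0, 1/d) the operator T_δ is a local contraction with respect to the span seminorm: for every M > 0 there exists a constant L ∈ (0,1) (depending on δ and M) such that for all continuous functions v₁, v₂ : S → ℝ with ‖v₁‖ ≤ M and ‖v₂‖ ≤ M, ‖T_δ v₁ − T_δ v₂‖_sp ≤ L · ‖v₁ − v₂‖_sp. -/

import Mathlib

open MeasureTheory Set

noncomputable section

/-- Standard scalar product on `ℝ^d`. -/
def ip {d : ℕ} (x y : Fin d → ℝ) : ℝ := ∑ i, x i * y i

/-- `G(x,y) = (x·y)/⟨x,y⟩` (componentwise product, normalised). -/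
def Gmap {d : ℕ} (x y : Fin d → ℝ) : Fin d → ℝ := fun i => x i * y i / ip x y

/-- `S_δ`, the set of allocations in the simplex with all weights at least `δ`. -/
def Sdel {d : ℕ} (δ : ℝ) : Set (Fin d → ℝ) := {π ∈ stdSimplex ℝ (Fin d) | ∀ i, δ ≤ π i}

/-- The restricted Bellman operator
`(T_δ v)(π) = sup_{π' ∈ S_δ} [γ ln s(π,π') + ln E[exp(γ ln⟨π',w⟩ + v(G(π',w)))]]`. -/
def Tdel {d : ℕ} {Ω : Type*} [MeasurableSpace Ω] (P : Measure Ω) (γ : ℝ)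
    (s : (Fin d → ℝ) → (Fin d → ℝ) → ℝ) (r : Ω → Fin d → ℝ) (δ : ℝ)
    (v : (Fin d → ℝ) → ℝ) (π : Fin d → ℝ) : ℝ :=
  sSup ((fun π' => γ * Real.log (s π π') +
      Real.log (∫ ω, Real.exp (γ * Real.log (ip π' (fun i => Real.exp (r ω i))) +
        v (Gmap π' (fun i => Real.exp (r ω i)))) ∂P)) '' Sdel δ)

/-- Span seminorm `‖v‖_sp = sup_{π,π' ∈ S} (v(π) − v(π'))/2`. -/
def spanSemi {d : ℕ} (f : (Fin d → ℝ) → ℝ) : ℝ :=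
  sSup {y | ∃ π ∈ stdSimplex ℝ (Fin d), ∃ π' ∈ stdSimplex ℝ (Fin d), y = (f π - f π') / 2}

/-- On a probability space, the integral of a positive function over a set of probability at least
`ε` is bounded below by a positive constant independent of the set. -/
lemma exists_pos_le_setIntegral {Ω : Type*} [MeasurableSpace Ω] (P : Measure Ω)
    [IsProbabilityMeasure P] {ρ : Ω → ℝ} (hρm : Measurable ρ) (hρ : ∀ ω, 0 < ρ ω)
    (hρi : Integrable ρ P) {ε : ℝ} (hε : 0 < ε) :
    ∃ η > 0, ∀ B, MeasurableSet B → ε ≤ P.real B → η ≤ ∫ ω in B, ρ ω ∂P := by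
  have hmono : Monotone (fun n : ℕ => {ω | 1 / ((n : ℝ) + 1) ≤ ρ ω}) := fun m n hmn ω hω =>
    (Nat.one_div_le_one_div hmn).trans (show 1 / ((m : ℝ) + 1) ≤ ρ ω from hω)
  have hunion : (⋃ n : ℕ, {ω | 1 / ((n : ℝ) + 1) ≤ ρ ω}) = univ := by
    refine eq_univ_of_forall fun ω => mem_iUnion.2 ?_
    obtain ⟨n, hn⟩ := exists_nat_one_div_lt (hρ ω)
    exact ⟨n, hn.le⟩
  have htend : Filter.Tendsto (fun n : ℕ => P.real {ω | 1 / ((n : ℝ) + 1) ≤ ρ ω})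
      Filter.atTop (nhds 1) := by
    have h := tendsto_measure_iUnion_atTop (μ := P) hmono
    rw [hunion, measure_univ] at h
    exact (ENNReal.tendsto_toReal ENNReal.one_ne_top).comp h
  obtain ⟨n, hn⟩ := (htend.eventually (lt_mem_nhds (show 1 - ε / 2 < 1 by linarith))).exists
  have ht : 0 < 1 / ((n : ℝ) + 1) := Nat.one_div_pos_of_nat
  set t := 1 / ((n : ℝ) + 1)
  set E := {ω | t ≤ ρ ω}
  have hE : MeasurableSet E := measurableSet_le measurable_const hρm
  refine ⟨t * (ε / 2), by positivity, fun B hB hPB => ?_⟩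
  have hcompl : P.real (B \ E) ≤ ε / 2 := by
    have h1 : P.real (B \ E) ≤ P.real Eᶜ := measureReal_mono (fun ω hω => hω.2)
    rw [probReal_compl_eq_one_sub hE] at h1
    linarith
  have hinter : ε / 2 ≤ P.real (B ∩ E) := by
    have := measureReal_inter_add_sdiff (μ := P) (s := B) hE
    linarith
  calc t * (ε / 2) ≤ t * P.real (B ∩ E) := by gcongr
    _ ≤ ∫ ω in B ∩ E, ρ ω ∂P :=
      setIntegral_ge_of_const_le_real (hB.inter hE) (measure_ne_top _ _) (fun ω hω => hω.2)
        hρi.integrableOn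
    _ ≤ ∫ ω in B, ρ ω ∂P :=
      setIntegral_mono_set hρi.integrableOn (ae_of_all _ fun ω => (hρ ω).le)
        (ae_of_all _ fun ω hω => hω.1)

/-- Gibbs' inequality: the logarithm of an exponential moment dominates the mean. -/
lemma log_integral_add_mean_le {Ω : Type*} [MeasurableSpace Ω] {P : Measure Ω} {f h : Ω → ℝ}
    (hf : ∀ ω, 0 ≤ f ω) (hfi : Integrable f P) (hpos : 0 < ∫ ω, f ω ∂P)
    (hfh : Integrable (fun ω => f ω * h ω) P)
    (hfe : Integrable (fun ω => f ω * Real.exp (h ω)) P) :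
    Real.log (∫ ω, f ω ∂P) + (∫ ω, f ω * h ω ∂P) / ∫ ω, f ω ∂P ≤
      Real.log (∫ ω, f ω * Real.exp (h ω) ∂P) := by
  set c := (∫ ω, f ω * h ω ∂P) / ∫ ω, f ω ∂P with hc
  have hcm : c * ∫ ω, f ω ∂P = ∫ ω, f ω * h ω ∂P := div_mul_cancel₀ _ hpos.ne'
  have key : Real.exp c * ∫ ω, f ω ∂P ≤ ∫ ω, f ω * Real.exp (h ω) ∂P := by
    calc Real.exp c * ∫ ω, f ω ∂P
        = ∫ ω, Real.exp c * ((1 - c) * f ω + f ω * h ω) ∂P := by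
          rw [integral_const_mul, integral_add (hfi.const_mul _) hfh, integral_const_mul, ← hcm]
          ring
      _ ≤ _ := by
          refine integral_mono (((hfi.const_mul _).add hfh).const_mul _) hfe fun ω => ?_
          have h1 : Real.exp (h ω) = Real.exp c * Real.exp (h ω - c) := by
            rw [← Real.exp_add]; congr 1; ring
          have h2 := Real.add_one_le_exp (h ω - c)
          have h3 : 0 ≤ Real.exp c * f ω := mul_nonneg (Real.exp_pos c).le (hf ω)
          have h4 := mul_le_mul_of_nonneg_left h2 h3
          simp only [h1]
          linarith
  have := Real.log_le_log (mul_pos (Real.exp_pos c) hpos) key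
  rwa [Real.log_mul (Real.exp_pos c).ne' hpos.ne', Real.log_exp, add_comm] at this

/-- A weighted mean of a function bounded by `b` is at most `b - ε D` when the function is at most
`b - D` on a set carrying a fraction at least `ε` of the weight. -/
lemma mean_le_sub_of_le_on {Ω : Type*} [MeasurableSpace Ω] {P : Measure Ω} {f u : Ω → ℝ}
    (hf : ∀ ω, 0 ≤ f ω) (hfi : Integrable f P) (hpos : 0 < ∫ ω, f ω ∂P)
    (hfu : Integrable (fun ω => f ω * u ω) P) {b D ε : ℝ} (hD : 0 ≤ D) {B : Set Ω}
    (hB : MeasurableSet B) (hub : ∀ ω, u ω ≤ b) (huB : ∀ ω ∈ B, u ω ≤ b - D)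
    (hε : ε * ∫ ω, f ω ∂P ≤ ∫ ω in B, f ω ∂P) :
    (∫ ω, f ω * u ω ∂P) / ∫ ω, f ω ∂P ≤ b - ε * D := by
  rw [div_le_iff₀ hpos]
  have hBi : Integrable (B.indicator f) P := hfi.indicator hB
  calc ∫ ω, f ω * u ω ∂P ≤ ∫ ω, (b * f ω - D * B.indicator f ω) ∂P := by
        refine integral_mono hfu ((hfi.const_mul _).sub (hBi.const_mul _)) fun ω => ?_
        by_cases h : ω ∈ B
        · have := mul_le_mul_of_nonneg_left (huB ω h) (hf ω)
          simp only [indicator_of_mem h]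
          linarith
        · have := mul_le_mul_of_nonneg_left (hub ω) (hf ω)
          simp only [indicator_of_notMem h]
          linarith
    _ = b * ∫ ω, f ω ∂P - D * ∫ ω in B, f ω ∂P := by
        rw [integral_sub (hfi.const_mul _) (hBi.const_mul _), integral_const_mul,
          integral_const_mul, integral_indicator hB]
    _ ≤ (b - ε * D) * ∫ ω, f ω ∂P := by
        have := mul_le_mul_of_nonneg_left hε hD
        linarith

lemma sSup_image_le_sSup_image_add {α : Type*} {S : Set α} (hS : S.Nonempty) {f g : α → ℝ}
    (hg : BddAbove (g '' S)) {C : ℝ} (h : ∀ a ∈ S, f a ≤ g a + C) :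
    sSup (f '' S) ≤ sSup (g '' S) + C := by
  refine csSup_le (hS.image f) ?_
  rintro _ ⟨a, ha, rfl⟩
  have := le_csSup hg (mem_image_of_mem g ha)
  linarith [h a ha]

lemma ip_pos {d : ℕ} (hd : 0 < d) {δ : ℝ} (hδ : 0 < δ) {π y : Fin d → ℝ} (hπ : π ∈ Sdel δ)
    (hy : ∀ i, 0 < y i) : 0 < ip π y :=
  Finset.sum_pos (fun i _ => mul_pos (hδ.trans_le (hπ.2 i)) (hy i)) ⟨⟨0, hd⟩, Finset.mem_univ _⟩

lemma Gmap_mem_stdSimplex {d : ℕ} {π y : Fin d → ℝ} (hπ : ∀ i, 0 ≤ π i) (hy : ∀ i, 0 ≤ y i)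
    (hip : 0 < ip π y) : Gmap π y ∈ stdSimplex ℝ (Fin d) := by
  refine ⟨fun i => div_nonneg (mul_nonneg (hπ i) (hy i)) hip.le, ?_⟩
  simp only [Gmap, ← Finset.sum_div]
  exact div_self hip.ne'

/-- The exponential weights in the definition of `Tdel` are measurable and comparable to
`(∑ i, exp (r i)) ^ γ`, uniformly in the allocation. -/
lemma weight_bounds {d : ℕ} (hd : 0 < d) {Ω : Type*} [MeasurableSpace Ω] {γ : ℝ} (hγ : γ < 0)
    {r : Ω → Fin d → ℝ} (hrm : Measurable r) {δ : ℝ} (hδ : 0 < δ) {M : ℝ}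
    {v : (Fin d → ℝ) → ℝ} (hv : ContinuousOn v (stdSimplex ℝ (Fin d)))
    (hvM : ∀ π ∈ stdSimplex ℝ (Fin d), |v π| ≤ M) {a : Fin d → ℝ} (ha : a ∈ Sdel δ) :
    Measurable (fun ω => v (Gmap a (fun i => Real.exp (r ω i)))) ∧
    Measurable (fun ω => Real.exp (γ * Real.log (ip a (fun i => Real.exp (r ω i))) +
      v (Gmap a (fun i => Real.exp (r ω i))))) ∧
    ∀ ω, Real.exp (-M) * Real.exp (γ * Real.log (∑ i, Real.exp (r ω i))) ≤
        Real.exp (γ * Real.log (ip a (fun i => Real.exp (r ω i))) +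
          v (Gmap a (fun i => Real.exp (r ω i)))) ∧
      Real.exp (γ * Real.log (ip a (fun i => Real.exp (r ω i))) +
          v (Gmap a (fun i => Real.exp (r ω i)))) ≤
        Real.exp (γ * Real.log δ + M) * Real.exp (γ * Real.log (∑ i, Real.exp (r ω i))) := by
  have hip : ∀ ω, 0 < ip a (fun i => Real.exp (r ω i)) := fun ω =>
    ip_pos hd hδ ha fun i => Real.exp_pos _
  have hG : ∀ ω, Gmap a (fun i => Real.exp (r ω i)) ∈ stdSimplex ℝ (Fin d) := fun ω =>
    Gmap_mem_stdSimplex ha.1.1 (fun i => (Real.exp_pos _).le) (hip ω)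
  have hri : ∀ i, Measurable (fun ω => r ω i) := fun i => (measurable_pi_apply i).comp hrm
  have hipm : Measurable (fun ω => ip a (fun i => Real.exp (r ω i))) :=
    Finset.measurable_fun_sum _ fun i _ => (hri i).exp.const_mul _
  have hGm : Measurable (fun ω => Gmap a (fun i => Real.exp (r ω i))) :=
    measurable_pi_lambda _ fun i => ((hri i).exp.const_mul _).div hipm
  have hvG : Measurable (fun ω => v (Gmap a (fun i => Real.exp (r ω i)))) :=
    (continuousOn_iff_continuous_domRestrict.1 hv).measurable.comp (hGm.subtype_mk (h := hG))
  refine ⟨hvG, ((hipm.log.const_mul γ).add hvG).exp, fun ω => ?_⟩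
  have hsum : 0 < ∑ i, Real.exp (r ω i) :=
    Finset.sum_pos (fun i _ => Real.exp_pos _) ⟨⟨0, hd⟩, Finset.mem_univ _⟩
  have hvω := abs_le.1 (hvM _ (hG ω))
  have hle : ip a (fun i => Real.exp (r ω i)) ≤ ∑ i, Real.exp (r ω i) :=
    Finset.sum_le_sum fun i _ =>
      mul_le_of_le_one_left (Real.exp_pos _).le (mem_Icc_of_mem_stdSimplex ha.1 i).2
  have hge : δ * ∑ i, Real.exp (r ω i) ≤ ip a (fun i => Real.exp (r ω i)) := by
    rw [Finset.mul_sum]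
    exact Finset.sum_le_sum fun i _ => mul_le_mul_of_nonneg_right (ha.2 i) (Real.exp_pos _).le
  have h1 := mul_le_mul_of_nonpos_left (Real.log_le_log (hip ω) hle) hγ.le
  have h2 := mul_le_mul_of_nonpos_left (Real.log_le_log (mul_pos hδ hsum) hge) hγ.le
  rw [Real.log_mul hδ.ne' hsum.ne'] at h2
  rw [← Real.exp_add, ← Real.exp_add, Real.exp_le_exp, Real.exp_le_exp]
  constructor <;> linarith

lemma Sdel_subset {d : ℕ} {δ : ℝ} : (Sdel δ : Set (Fin d → ℝ)) ⊆ stdSimplex ℝ (Fin d) :=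
  fun _ h => h.1

lemma Sdel_nonempty {d : ℕ} (hd : 0 < d) {δ : ℝ} (hδ : δ ≤ 1 / d) :
    (Sdel δ : Set (Fin d → ℝ)).Nonempty := by
  refine ⟨fun _ => 1 / d, ⟨fun _ => by positivity, ?_⟩, fun _ => hδ⟩
  have : (d : ℝ) ≠ 0 := by positivity
  simp [this]

lemma sub_le_two_mul_spanSemi {d : ℕ} {f : (Fin d → ℝ) → ℝ} {C : ℝ}
    (hf : ∀ x ∈ stdSimplex ℝ (Fin d), |f x| ≤ C) {x y : Fin d → ℝ}
    (hx : x ∈ stdSimplex ℝ (Fin d)) (hy : y ∈ stdSimplex ℝ (Fin d)) :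
    f x - f y ≤ 2 * spanSemi f := by
  have hb : BddAbove {z | ∃ π ∈ stdSimplex ℝ (Fin d), ∃ π' ∈ stdSimplex ℝ (Fin d),
      z = (f π - f π') / 2} := by
    refine ⟨C, ?_⟩
    rintro _ ⟨p, hp, q, hq, rfl⟩
    linarith [(abs_le.1 (hf p hp)).2, (abs_le.1 (hf q hq)).1]
  have : (f x - f y) / 2 ≤ spanSemi f := le_csSup hb ⟨x, hx, y, hy, rfl⟩
  linarith

/-- local contraction: for `γ < 0`, under (A.1) and the mixing
assumption (A.2), for each `δ ∈ (0, 1/d)` the operator `T_δ` is a local contraction in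
the span seminorm: for every `M > 0` there is `L ∈ (0,1)` such that
`‖T_δv₁ − T_δv₂‖_sp ≤ L ‖v₁ − v₂‖_sp` whenever `‖v₁‖, ‖v₂‖ ≤ M`. -/
theorem restricted_bellman_local_contraction {d : ℕ} (hd : 0 < d)
    {Ω : Type*} [MeasurableSpace Ω]
    (P : Measure Ω) [IsProbabilityMeasure P]
    (st : ℝ) (hst : st ∈ Ioo (0 : ℝ) 1)
    (s : (Fin d → ℝ) → (Fin d → ℝ) → ℝ)
    (hs : ∀ x ∈ stdSimplex ℝ (Fin d), ∀ y ∈ stdSimplex ℝ (Fin d), s x y ∈ Icc st 1)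
    (hscont : ContinuousOn (fun p : (Fin d → ℝ) × (Fin d → ℝ) => s p.1 p.2)
      (stdSimplex ℝ (Fin d) ×ˢ stdSimplex ℝ (Fin d)))
    (γ : ℝ) (hγ : γ < 0) (r : Ω → Fin d → ℝ) (hrm : Measurable r)
    (hA1exp : ∀ i, Integrable (fun ω => Real.exp (γ * r ω i)) P)
    (hA1int : ∀ i, Integrable (fun ω => r ω i) P)
    (hA2 : ∀ δ ∈ Ioo (0 : ℝ) (1 / d), ∃ κ < (1 : ℝ),
      ∀ A : Set (Fin d → ℝ), MeasurableSet A →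
        ∀ π ∈ Sdel δ, ∀ π' ∈ Sdel δ,
          (P {ω | Gmap π (fun i => Real.exp (r ω i)) ∈ A}).toReal -
            (P {ω | Gmap π' (fun i => Real.exp (r ω i)) ∈ A}).toReal ≤ κ)
    (δ : ℝ) (hδ : δ ∈ Ioo (0 : ℝ) (1 / d)) :
    ∀ M > (0 : ℝ), ∃ L ∈ Ioo (0 : ℝ) 1,
      ∀ v₁ v₂ : (Fin d → ℝ) → ℝ,
        ContinuousOn v₁ (stdSimplex ℝ (Fin d)) →
        ContinuousOn v₂ (stdSimplex ℝ (Fin d)) →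
        (∀ π ∈ stdSimplex ℝ (Fin d), |v₁ π| ≤ M) →
        (∀ π ∈ stdSimplex ℝ (Fin d), |v₂ π| ≤ M) →
        spanSemi (fun π => Tdel P γ s r δ v₁ π - Tdel P γ s r δ v₂ π) ≤
          L * spanSemi (fun π => v₁ π - v₂ π) := by
  intro M hM
  have hδ0 := hδ.1
  obtain ⟨κ, hκ, hmix⟩ := hA2 δ hδ
  set i₀ : Fin d := ⟨0, hd⟩
  set ρ : Ω → ℝ := fun ω => Real.exp (γ * Real.log (∑ i, Real.exp (r ω i)))
  have hρpos : ∀ ω, 0 < ρ ω := fun ω => Real.exp_pos _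
  have hri : ∀ i, Measurable (fun ω => r ω i) := fun i => (measurable_pi_apply i).comp hrm
  have hρm : Measurable ρ :=
    ((Finset.measurable_fun_sum _ fun i _ => (hri i).exp).log.const_mul γ).exp
  have hρi : Integrable ρ P := by
    refine (hA1exp i₀).mono' hρm.aestronglyMeasurable (ae_of_all _ fun ω => ?_)
    rw [Real.norm_of_nonneg (hρpos ω).le, Real.exp_le_exp]
    refine mul_le_mul_of_nonpos_left ?_ hγ.le
    rw [Real.le_log_iff_exp_le (Finset.sum_pos (fun i _ => Real.exp_pos _)
      ⟨i₀, Finset.mem_univ _⟩)]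
    exact Finset.single_le_sum (f := fun i => Real.exp (r ω i))
      (fun i _ => (Real.exp_pos _).le) (Finset.mem_univ i₀)
  obtain ⟨η, hη, hηB⟩ := exists_pos_le_setIntegral P hρm hρpos hρi
    (show 0 < (1 - κ) / 2 by linarith)
  have hIρ : 0 < ∫ ω, ρ ω ∂P := by
    rw [integral_pos_iff_support_of_nonneg (fun ω => (hρpos ω).le) hρi,
      Function.support_eq_univ fun ω => (hρpos ω).ne', measure_univ]
    exact one_pos
  set K := Real.exp (γ * Real.log δ + M) * ∫ ω, ρ ω ∂P with hKdef
  have hK : 0 < K := mul_pos (Real.exp_pos _) hIρ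
  set ε := min 1 (Real.exp (-M) * η / K)
  have hε0 : 0 < ε := lt_min one_pos (by positivity)
  have hε1 : ε ≤ 1 := min_le_left _ _
  have hεK : ε * K ≤ Real.exp (-M) * η := (le_div_iff₀ hK).1 (min_le_right _ _)
  refine ⟨1 - ε / 2, ⟨by linarith, by linarith⟩, fun v₁ v₂ hc₁ hc₂ hb₁ hb₂ => ?_⟩
  let F : ((Fin d → ℝ) → ℝ) → (Fin d → ℝ) → Ω → ℝ := fun v a ω =>
    Real.exp (γ * Real.log (ip a (fun i => Real.exp (r ω i))) +
      v (Gmap a (fun i => Real.exp (r ω i))))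
  have hF : ∀ v : (Fin d → ℝ) → ℝ, ContinuousOn v (stdSimplex ℝ (Fin d)) →
      (∀ π ∈ stdSimplex ℝ (Fin d), |v π| ≤ M) → ∀ a ∈ (Sdel δ : Set (Fin d → ℝ)),
      Integrable (F v a) P ∧ 0 < ∫ ω, F v a ω ∂P ∧ ∫ ω, F v a ω ∂P ≤ K ∧
      ∀ B, MeasurableSet B → (1 - κ) / 2 ≤ P.real B →
        ε * ∫ ω, F v a ω ∂P ≤ ∫ ω in B, F v a ω ∂P := by
    intro v hc hb a ha
    obtain ⟨-, hm, hbd⟩ := weight_bounds hd hγ hrm hδ0 hc hb ha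
    have hint : Integrable (F v a) P := by
      refine (hρi.const_mul (Real.exp (γ * Real.log δ + M))).mono' hm.aestronglyMeasurable
        (ae_of_all _ fun ω => ?_)
      rw [Real.norm_of_nonneg (Real.exp_pos _).le]
      exact (hbd ω).2
    have hub : ∫ ω, F v a ω ∂P ≤ K := by
      rw [hKdef, ← integral_const_mul]
      exact integral_mono hint (hρi.const_mul _) fun ω => (hbd ω).2
    refine ⟨hint, ?_, hub, fun B hB hPB => ?_⟩
    · refine (mul_pos (Real.exp_pos (-M)) hIρ).trans_le ?_
      rw [← integral_const_mul]
      exact integral_mono (hρi.const_mul _) hint fun ω => (hbd ω).1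
    · calc ε * ∫ ω, F v a ω ∂P ≤ ε * K := by gcongr
        _ ≤ Real.exp (-M) * η := hεK
        _ ≤ Real.exp (-M) * ∫ ω in B, ρ ω ∂P := by gcongr; exact hηB B hB hPB
        _ = ∫ ω in B, Real.exp (-M) * ρ ω ∂P := (integral_const_mul _ _).symm
        _ ≤ ∫ ω in B, F v a ω ∂P :=
          setIntegral_mono (hρi.const_mul _).integrableOn hint.integrableOn fun ω => (hbd ω).1
  set u : (Fin d → ℝ) → ℝ := fun π => v₁ π - v₂ π with hu
  have huc : ContinuousOn u (stdSimplex ℝ (Fin d)) := hc₁.sub hc₂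
  have hub : ∀ π ∈ stdSimplex ℝ (Fin d), |u π| ≤ 2 * M := fun π hπ =>
    (abs_sub _ _).trans (by linarith [hb₁ π hπ, hb₂ π hπ])
  obtain ⟨p, hp⟩ := Sdel_nonempty hd hδ.2.le
  have hne : (stdSimplex ℝ (Fin d)).Nonempty := ⟨p, hp.1⟩
  set D := 2 * spanSemi u
  have hosc : ∀ x ∈ stdSimplex ℝ (Fin d), ∀ y ∈ stdSimplex ℝ (Fin d), u x - u y ≤ D :=
    fun x hx y hy => sub_le_two_mul_spanSemi hub hx hy
  have hD0 : 0 ≤ D := by simpa using hosc p hp.1 p hp.1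
  obtain ⟨m, hml, hmu⟩ : ∃ m, (∀ x ∈ stdSimplex ℝ (Fin d), m ≤ u x) ∧
      ∀ x ∈ stdSimplex ℝ (Fin d), u x ≤ m + D := by
    have hbb : BddBelow (u '' stdSimplex ℝ (Fin d)) := by
      refine ⟨-(2 * M), ?_⟩
      rintro _ ⟨x, hx, rfl⟩
      exact (abs_le.1 (hub x hx)).1
    refine ⟨sInf (u '' stdSimplex ℝ (Fin d)), fun x hx => csInf_le hbb ⟨x, hx, rfl⟩,
      fun x hx => ?_⟩
    have : u x - D ≤ sInf (u '' stdSimplex ℝ (Fin d)) := by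
      refine le_csInf (hne.image u) ?_
      rintro _ ⟨y, hy, rfl⟩
      linarith [hosc x hx y hy]
    linarith
  set A : Set (Fin d → ℝ) := stdSimplex ℝ (Fin d) ∩ u ⁻¹' Ici (m + D / 2)
  have hAm : MeasurableSet A :=
    (huc.preimage_isClosed_of_isClosed (isClosed_stdSimplex _ _) isClosed_Ici).measurableSet
  have hGS : ∀ a ∈ (Sdel δ : Set (Fin d → ℝ)), ∀ ω,
      Gmap a (fun i => Real.exp (r ω i)) ∈ stdSimplex ℝ (Fin d) := fun a ha ω =>
    Gmap_mem_stdSimplex ha.1.1 (fun i => (Real.exp_pos _).le)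
      (ip_pos hd hδ0 ha fun i => Real.exp_pos _)
  have hum : ∀ a ∈ (Sdel δ : Set (Fin d → ℝ)),
      Measurable fun ω => u (Gmap a (fun i => Real.exp (r ω i))) := fun a ha =>
    (weight_bounds hd hγ hrm hδ0 huc hub ha).1
  let E : (Fin d → ℝ) → Set Ω := fun a => {ω | Gmap a (fun i => Real.exp (r ω i)) ∈ A}
  have hEeq : ∀ a ∈ (Sdel δ : Set (Fin d → ℝ)),
      E a = {ω | m + D / 2 ≤ u (Gmap a (fun i => Real.exp (r ω i)))} := fun a ha => by
    ext ω
    exact ⟨fun h => h.2, fun h => ⟨hGS a ha ω, h⟩⟩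
  have hEm : ∀ a ∈ (Sdel δ : Set (Fin d → ℝ)), MeasurableSet (E a) := fun a ha => by
    rw [hEeq a ha]
    exact measurableSet_le measurable_const (hum a ha)
  have hbdd_mul : ∀ a ∈ (Sdel δ : Set (Fin d → ℝ)), ∀ f : Ω → ℝ, Integrable f P →
      Integrable (fun ω => f ω * u (Gmap a (fun i => Real.exp (r ω i)))) P := fun a ha f hf =>
    hf.mul_bdd (c := 2 * M) (hum a ha).aestronglyMeasurable
      (ae_of_all _ fun ω => hub _ (hGS a ha ω))
  have hdiff : ∀ a ∈ (Sdel δ : Set (Fin d → ℝ)), ∀ b ∈ (Sdel δ : Set (Fin d → ℝ)),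
      Real.log (∫ ω, F v₁ a ω ∂P) - Real.log (∫ ω, F v₂ a ω ∂P) ≤
        Real.log (∫ ω, F v₁ b ω ∂P) - Real.log (∫ ω, F v₂ b ω ∂P) + (1 - ε / 2) * D := by
    intro a ha b hb
    obtain ⟨hia, hpa, -, hBa⟩ := hF v₁ hc₁ hb₁ a ha
    obtain ⟨hib, hpb, -, hBb⟩ := hF v₂ hc₂ hb₂ b hb
    have ea : (fun ω => F v₁ a ω * Real.exp (-u (Gmap a (fun i => Real.exp (r ω i))))) =
        F v₂ a := by
      funext ω
      simp only [F, hu, ← Real.exp_add]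
      congr 1; ring
    have eb : (fun ω => F v₂ b ω * Real.exp (u (Gmap b (fun i => Real.exp (r ω i))))) =
        F v₁ b := by
      funext ω
      simp only [F, hu, ← Real.exp_add]
      congr 1; ring
    have hmula := hbdd_mul a ha _ hia
    have hmulb := hbdd_mul b hb _ hib
    have hmula' : Integrable
        (fun ω => F v₁ a ω * -u (Gmap a (fun i => Real.exp (r ω i)))) P := by
      simpa only [mul_neg] using hmula.fun_neg
    have hmulb' : Integrable
        (fun ω => F v₂ b ω * -u (Gmap b (fun i => Real.exp (r ω i)))) P := by
      simpa only [mul_neg] using hmulb.fun_neg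
    have ga := log_integral_add_mean_le (fun ω => (Real.exp_pos _).le) hia hpa hmula'
      (by rw [ea]; exact (hF v₂ hc₂ hb₂ a ha).1)
    have gb := log_integral_add_mean_le (fun ω => (Real.exp_pos _).le) hib hpb hmulb
      (by rw [eb]; exact (hF v₁ hc₁ hb₁ b hb).1)
    rw [ea] at ga
    rw [eb] at gb
    simp only [mul_neg, integral_neg, neg_div] at ga
    have hma : ∀ (ε' : ℝ) (B : Set Ω), MeasurableSet B →
        (∀ ω ∈ B, u (Gmap a (fun i => Real.exp (r ω i))) ≤ m + D - D / 2) →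
        ε' * ∫ ω, F v₁ a ω ∂P ≤ ∫ ω in B, F v₁ a ω ∂P →
        (∫ ω, F v₁ a ω * u (Gmap a (fun i => Real.exp (r ω i))) ∂P) / ∫ ω, F v₁ a ω ∂P ≤
          m + D - ε' * (D / 2) := fun ε' B hB h1 h2 =>
      mean_le_sub_of_le_on (fun ω => (Real.exp_pos _).le) hia hpa hmula (by linarith) hB
        (fun ω => hmu _ (hGS a ha ω)) h1 h2
    have hmb : ∀ (ε' : ℝ) (B : Set Ω), MeasurableSet B →
        (∀ ω ∈ B, -u (Gmap b (fun i => Real.exp (r ω i))) ≤ -m - D / 2) →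
        ε' * ∫ ω, F v₂ b ω ∂P ≤ ∫ ω in B, F v₂ b ω ∂P →
        -((∫ ω, F v₂ b ω * u (Gmap b (fun i => Real.exp (r ω i))) ∂P) / ∫ ω, F v₂ b ω ∂P) ≤
          -m - ε' * (D / 2) := fun ε' B hB h1 h2 => by
      have := mean_le_sub_of_le_on (fun ω => (Real.exp_pos _).le) hib hpb hmulb'
        (by linarith) hB (fun ω => neg_le_neg (hml _ (hGS b hb ω))) h1 h2
      simpa only [mul_neg, integral_neg, neg_div] using this
    have hmixab : P.real (E a) - P.real (E b) ≤ κ := hmix A hAm a ha b hb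
    by_cases hcase : (1 - κ) / 2 ≤ P.real (E a)ᶜ
    · have h1 := hma ε (E a)ᶜ (hEm a ha).compl (fun ω hω => by
        rw [hEeq a ha, mem_compl_iff, mem_ofPred_eq, not_le] at hω
        linarith) (hBa _ (hEm a ha).compl hcase)
      have h2 := hmb 0 ∅ MeasurableSet.empty (fun ω hω => hω.elim) (by simp)
      linarith
    · have hPb : (1 - κ) / 2 ≤ P.real (E b) := by
        rw [probReal_compl_eq_one_sub (hEm a ha)] at hcase
        linarith
      have h1 := hma 0 ∅ MeasurableSet.empty (fun ω hω => hω.elim) (by simp)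
      have h2 := hmb ε (E b) (hEm b hb) (fun ω hω => by
        rw [hEeq b hb, mem_ofPred_eq] at hω
        linarith) (hBb _ (hEm b hb) hPb)
      linarith
  have hbddT : ∀ v : (Fin d → ℝ) → ℝ, ContinuousOn v (stdSimplex ℝ (Fin d)) →
      (∀ π ∈ stdSimplex ℝ (Fin d), |v π| ≤ M) → ∀ π ∈ stdSimplex ℝ (Fin d),
      BddAbove ((fun a => γ * Real.log (s π a) + Real.log (∫ ω, F v a ω ∂P)) '' Sdel δ) := by
    intro v hc hb π hπ
    refine ⟨γ * Real.log st + Real.log K, ?_⟩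
    rintro _ ⟨a, ha, rfl⟩
    obtain ⟨-, hpos, hle, -⟩ := hF v hc hb a ha
    exact add_le_add
      (mul_le_mul_of_nonpos_left (Real.log_le_log hst.1 (hs π hπ a ha.1).1) hγ.le)
      (Real.log_le_log hpos hle)
  refine csSup_le ⟨_, p, hp.1, p, hp.1, rfl⟩ ?_
  rintro _ ⟨π, hπ, π', hπ', rfl⟩
  have hlower : ∀ b ∈ (Sdel δ : Set (Fin d → ℝ)),
      Tdel P γ s r δ v₁ π ≤ Tdel P γ s r δ v₂ π +
        (Real.log (∫ ω, F v₁ b ω ∂P) - Real.log (∫ ω, F v₂ b ω ∂P) + (1 - ε / 2) * D) :=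
    fun b hb => sSup_image_le_sSup_image_add ⟨p, hp⟩ (hbddT v₂ hc₂ hb₂ π hπ) fun a ha => by
      have := hdiff a ha b hb
      simp only [F] at this ⊢
      linarith
  have hupper : Tdel P γ s r δ v₂ π' ≤ Tdel P γ s r δ v₁ π' +
      (Tdel P γ s r δ v₂ π - Tdel P γ s r δ v₁ π + (1 - ε / 2) * D) :=
    sSup_image_le_sSup_image_add ⟨p, hp⟩ (hbddT v₁ hc₁ hb₁ π' hπ') fun a ha => by
      have := hlower a ha
      simp only [F] at this ⊢
      linarith
  linarith
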